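/- arXiv:2603.22351 — 8 statements merged into one kernel-verified Lean document; each statement's English description precedes it below -/
import Mathlib

section
/- Let A, B, C, O be points in the plane (identified with ℂ) such that O does not lie on the union of the segments [A,B], [B,C], [C,A]. Then ∠AOB + ∠BOC + ∠COA = 2π or ∠AOB + ∠BOC + ∠COA = −2π if O lies in the convex hull of {A, B, C}, and ∠AOB + ∠BOC + ∠COA = 0 otherwise. -/
/-- The oriented angle `∠AOB ∈ (−π, π]` with vertex `O`. -/
noncomputable def oangle (O A B : ℂ) : ℝ := Complex.arg ((B - O) / (A - O))

theorem im_div_mul_normSq {a : ℂ} (ha : a ≠ 0) (b : ℂ) :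
    (b / a).im * Complex.normSq a = a.re * b.im - a.im * b.re := by
  have := Complex.normSq_pos.2 ha
  rw [Complex.div_im]
  field_simp

theorem re_div_mul_normSq {a : ℂ} (ha : a ≠ 0) (b : ℂ) :
    (b / a).re * Complex.normSq a = a.re * b.re + a.im * b.im := by
  have := Complex.normSq_pos.2 ha
  rw [Complex.div_re]
  field_simp

theorem arg_div_neg_iff {a : ℂ} (ha : a ≠ 0) (b : ℂ) :
    Complex.arg (b / a) < 0 ↔ a.re * b.im - a.im * b.re < 0 := by
  have := Complex.normSq_pos.2 ha
  rw [Complex.arg_neg_iff, ← im_div_mul_normSq ha]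
  exact ⟨fun h => mul_neg_of_neg_of_pos h this, fun h => neg_of_mul_neg_left h this.le⟩

theorem arg_div_pos_iff {a : ℂ} (ha : a ≠ 0) {b : ℂ} (h : Complex.arg (b / a) ≠ Real.pi) :
    0 < Complex.arg (b / a) ↔ 0 < a.re * b.im - a.im * b.re := by
  rw [← im_div_mul_normSq ha, mul_pos_iff_of_pos_right (Complex.normSq_pos.2 ha)]
  have h1 := Complex.arg_nonneg_iff (z := b / a)
  have h2 := Complex.arg_eq_zero_iff (z := b / a)
  have h3 := Complex.arg_eq_pi_iff (z := b / a)
  constructor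
  · intro hp
    refine lt_of_le_of_ne (h1.1 hp.le) fun h0 => ?_
    rcases le_or_gt 0 (b / a).re with hr | hr
    · exact hp.ne' (h2.2 ⟨hr, h0.symm⟩)
    · exact h (h3.2 ⟨hr, h0.symm⟩)
  · intro hp
    exact lt_of_le_of_ne (h1.2 hp.le) fun h0 => hp.ne' (h2.1 h0.symm).2

theorem inner_nonneg_of_arg_div_eq_zero {a : ℂ} (ha : a ≠ 0) {b : ℂ}
    (h : Complex.arg (b / a) = 0) : 0 ≤ a.re * b.re + a.im * b.im := by
  rw [← re_div_mul_normSq ha]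
  exact mul_nonneg (Complex.arg_eq_zero_iff.1 h).1 (Complex.normSq_nonneg a)

theorem oangle_ne_pi {O A B : ℂ} (h : O ∉ segment ℝ A B) : oangle O A B ≠ Real.pi := by
  intro hpi
  have hA : A - O ≠ 0 := fun h0 => h (by
    rw [← sub_eq_zero.1 h0]; exact left_mem_segment ℝ A B)
  obtain ⟨hre, him⟩ := Complex.arg_eq_pi_iff.1 hpi
  set r := ((B - O) / (A - O)).re
  have hr : ((B - O) / (A - O)) = (r : ℂ) := Complex.ext rfl (by simpa using him)
  rw [div_eq_iff hA] at hr
  have hne : (1 - r : ℂ) ≠ 0 := by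
    exact_mod_cast (show (1 - r : ℝ) ≠ 0 by linarith)
  refine h ⟨-r / (1 - r), 1 / (1 - r), div_nonneg (by linarith) (by linarith),
    div_nonneg zero_le_one (by linarith), ?_, ?_⟩
  · rw [← add_div, div_eq_one_iff_eq (by linarith)]; ring
  · rw [Complex.real_smul, Complex.real_smul]
    push_cast
    field_simp
    linear_combination hr

theorem mem_convexHull_triple_iff {E : Type*} [AddCommGroup E] [Module ℝ E] {A B C P : E} :
    P ∈ convexHull ℝ ({A, B, C} : Set E) ↔ ∃ α β γ : ℝ, 0 ≤ α ∧ 0 ≤ β ∧ 0 ≤ γ ∧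
      α + β + γ = 1 ∧ α • A + β • B + γ • C = P := by
  constructor
  · rw [convexHull_insert (Set.insert_nonempty _ _), convexHull_pair, mem_convexJoin]
    rintro ⟨_, rfl, _, ⟨u, v, hu, hv, huv, rfl⟩, ⟨s, t, hs, ht, hst, rfl⟩⟩
    refine ⟨s, t * u, t * v, hs, mul_nonneg ht hu, mul_nonneg ht hv, ?_, ?_⟩
    · linear_combination t * huv + hst
    · module
  · rintro ⟨α, β, γ, hα, hβ, hγ, hs, rfl⟩
    have := (convex_convexHull ℝ ({A, B, C} : Set E)).sum_mem (t := Finset.univ)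
      (w := ![α, β, γ]) (z := ![A, B, C])
      (by intro i _; fin_cases i <;> assumption)
      (by simpa [Fin.sum_univ_three] using hs)
      (by intro i _; apply subset_convexHull; fin_cases i <;> simp)
    simpa [Fin.sum_univ_three] using this

theorem mem_convexHull_triple_of_smul_sub_eq_zero {E : Type*} [AddCommGroup E] [Module ℝ E]
    {A B C P : E} {u v w : ℝ} (hu : 0 < u) (hv : 0 < v) (hw : 0 < w)
    (h : u • (A - P) + v • (B - P) + w • (C - P) = 0) :
    P ∈ convexHull ℝ ({A, B, C} : Set E) := by
  have hs : 0 < u + v + w := by positivity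
  refine mem_convexHull_triple_iff.2 ⟨u / (u + v + w), v / (u + v + w), w / (u + v + w),
    by positivity, by positivity, by positivity, by field_simp, ?_⟩
  have h' : u • A + v • B + w • C = (u + v + w) • P := by
    rw [← sub_eq_zero, ← h]; module
  rw [← inv_smul_smul₀ hs.ne' P, ← h']
  module

theorem exists_arg_sum_eq_int_mul_two_pi {a b c : ℂ} (ha : a ≠ 0) (hb : b ≠ 0) (hc : c ≠ 0) :
    ∃ n : ℤ, Complex.arg (b / a) + Complex.arg (c / b) + Complex.arg (a / c)
      = n * (2 * Real.pi) := by
  have h : ((Complex.arg (b / a) + Complex.arg (c / b) + Complex.arg (a / c) : ℝ) :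
      Real.Angle) = 0 := by
    rw [Real.Angle.coe_add, Real.Angle.coe_add, Complex.arg_div_coe_angle hb ha,
      Complex.arg_div_coe_angle hc hb, Complex.arg_div_coe_angle ha hc]
    abel
  obtain ⟨n, hn⟩ := Real.Angle.coe_eq_zero_iff.1 h
  exact ⟨n, by rw [← hn, zsmul_eq_mul]⟩

theorem oangle_sum_cases {A B C O : ℂ} (hAB : O ∉ segment ℝ A B) (hBC : O ∉ segment ℝ B C)
    (hCA : O ∉ segment ℝ C A) :
    oangle O A B + oangle O B C + oangle O C A = 0 ∨
    oangle O A B + oangle O B C + oangle O C A = 2 * Real.pi ∨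
    oangle O A B + oangle O B C + oangle O C A = -(2 * Real.pi) := by
  have hA : A - O ≠ 0 := fun h0 => hAB (sub_eq_zero.1 h0 ▸ left_mem_segment ℝ A B)
  have hB : B - O ≠ 0 := fun h0 => hBC (sub_eq_zero.1 h0 ▸ left_mem_segment ℝ B C)
  have hC : C - O ≠ 0 := fun h0 => hCA (sub_eq_zero.1 h0 ▸ left_mem_segment ℝ C A)
  obtain ⟨n, hn⟩ := exists_arg_sum_eq_int_mul_two_pi hA hB hC
  change oangle O A B + oangle O B C + oangle O C A = _ at hn
  have h1 : oangle O A B ≤ Real.pi := Complex.arg_le_pi _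
  have h2 : oangle O B C ≤ Real.pi := Complex.arg_le_pi _
  have h3 : oangle O C A ≤ Real.pi := Complex.arg_le_pi _
  have h1' : -Real.pi < oangle O A B := Complex.neg_pi_lt_arg _
  have h2' : -Real.pi < oangle O B C := Complex.neg_pi_lt_arg _
  have h3' : -Real.pi < oangle O C A := Complex.neg_pi_lt_arg _
  have hpi := Real.pi_pos
  have hn1 : n < 2 := by
    have : (n : ℝ) < 2 := by nlinarith
    exact_mod_cast this
  have hn2 : -2 < n := by
    have : (-2 : ℝ) < n := by nlinarith
    exact_mod_cast this
  rw [hn]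
  interval_cases n <;> simp

theorem stmt0 (A B C O : ℂ)
    (h : O ∉ segment ℝ A B ∪ segment ℝ B C ∪ segment ℝ C A) :
    (O ∈ convexHull ℝ ({A, B, C} : Set ℂ) →
      oangle O A B + oangle O B C + oangle O C A = 2 * Real.pi ∨
      oangle O A B + oangle O B C + oangle O C A = -(2 * Real.pi)) ∧
    (O ∉ convexHull ℝ ({A, B, C} : Set ℂ) →
      oangle O A B + oangle O B C + oangle O C A = 0) := by
  simp only [Set.mem_union, not_or] at h
  obtain ⟨⟨hAB, hBC⟩, hCA⟩ := h
  have hA : A - O ≠ 0 := fun h0 => hAB (sub_eq_zero.1 h0 ▸ left_mem_segment ℝ A B)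
  have hB : B - O ≠ 0 := fun h0 => hBC (sub_eq_zero.1 h0 ▸ left_mem_segment ℝ B C)
  have hC : C - O ≠ 0 := fun h0 => hCA (sub_eq_zero.1 h0 ▸ left_mem_segment ℝ C A)
  have p1 : 0 < oangle O A B ↔ _ := arg_div_pos_iff hA (oangle_ne_pi hAB)
  have p2 : 0 < oangle O B C ↔ _ := arg_div_pos_iff hB (oangle_ne_pi hBC)
  have p3 : 0 < oangle O C A ↔ _ := arg_div_pos_iff hC (oangle_ne_pi hCA)
  have n1 : oangle O A B < 0 ↔ _ := arg_div_neg_iff hA (B - O)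
  have n2 : oangle O B C < 0 ↔ _ := arg_div_neg_iff hB (C - O)
  have n3 : oangle O C A < 0 ↔ _ := arg_div_neg_iff hC (A - O)
  have hcases := oangle_sum_cases hAB hBC hCA
  constructor
  · intro hO
    obtain ⟨α, β, γ, hα, hβ, hγ, hs, hP⟩ := mem_convexHull_triple_iff.1 hO
    have hα : 0 < α := hα.lt_of_ne' fun h0 => hBC
      ⟨β, γ, hβ, hγ, by linarith, by rw [← hP, h0]; simp⟩
    have hβ : 0 < β := hβ.lt_of_ne' fun h0 => hCA
      ⟨γ, α, hγ, hα.le, by linarith, by rw [← hP, h0]; module⟩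
    have hγ : 0 < γ := hγ.lt_of_ne' fun h0 => hAB
      ⟨α, β, hα.le, hβ.le, by linarith, by rw [← hP, h0]; simp⟩
    have hz : α • (A - O) + β • (B - O) + γ • (C - O) = 0 := by
      calc _ = (α • A + β • B + γ • C) - (α + β + γ) • O := by module
        _ = 0 := by rw [hP, hs, one_smul, sub_self]
    have i1 : oangle O A B = 0 → _ := inner_nonneg_of_arg_div_eq_zero hA
    have i3 : oangle O C A = 0 → _ := inner_nonneg_of_arg_div_eq_zero hC
    have hsq := Complex.normSq_pos.2 hA
    rw [Complex.normSq_apply] at hsq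
    generalize oangle O A B = θ₁ at *
    generalize oangle O B C = θ₂ at *
    generalize oangle O C A = θ₃ at *
    generalize A - O = a at *
    generalize B - O = b at *
    generalize C - O = c at *
    have hre := congrArg Complex.re hz
    have him := congrArg Complex.im hz
    simp only [Complex.add_re, Complex.add_im, Complex.real_smul, Complex.re_ofReal_mul,
      Complex.im_ofReal_mul, Complex.zero_re, Complex.zero_im] at hre him
    have e1 : α * (a.re * b.im - a.im * b.re) = γ * (b.re * c.im - b.im * c.re) := by
      linear_combination b.im * hre - b.re * him
    have e2 : β * (a.re * b.im - a.im * b.re) = γ * (c.re * a.im - c.im * a.re) := by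
      linear_combination a.re * him - a.im * hre
    rcases lt_trichotomy (a.re * b.im - a.im * b.re) 0 with hlt | heq | hgt
    · have t1 := n1.2 hlt
      have t2 := n2.2 (neg_of_mul_neg_right (e1 ▸ mul_neg_of_pos_of_neg hα hlt) hγ.le)
      have t3 := n3.2 (neg_of_mul_neg_right (e2 ▸ mul_neg_of_pos_of_neg hβ hlt) hγ.le)
      exact hcases.resolve_left (by linarith)
    · exfalso
      rw [heq, mul_zero] at e2
      have h3 := (mul_eq_zero.1 e2.symm).resolve_left hγ.ne'
      have t1 : θ₁ = 0 := by
        rcases lt_trichotomy θ₁ 0 with t | t | t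
        · exact absurd (n1.1 t) (by linarith)
        · exact t
        · exact absurd (p1.1 t) (by linarith)
      have t3 : θ₃ = 0 := by
        rcases lt_trichotomy θ₃ 0 with t | t | t
        · exact absurd (n3.1 t) (by linarith)
        · exact t
        · exact absurd (p3.1 t) (by linarith)
      have d1 := mul_nonneg hβ.le (i1 t1)
      have d3 := mul_nonneg hγ.le (i3 t3)
      have d0 := mul_pos hα hsq
      linarith [show α * (a.re * a.re + a.im * a.im) + β * (a.re * b.re + a.im * b.im) +
        γ * (c.re * a.re + c.im * a.im) = 0 by linear_combination a.re * hre + a.im * him]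
    · have t1 := p1.2 hgt
      have t2 := p2.2 (pos_of_mul_pos_right (e1 ▸ mul_pos hα hgt) hγ.le)
      have t3 := p3.2 (pos_of_mul_pos_right (e2 ▸ mul_pos hβ hgt) hγ.le)
      exact hcases.resolve_left (by linarith)
  · intro hO
    have l1 : oangle O A B < Real.pi := (Complex.arg_le_pi _).lt_of_ne (oangle_ne_pi hAB)
    have l2 : oangle O B C < Real.pi := (Complex.arg_le_pi _).lt_of_ne (oangle_ne_pi hBC)
    have l3 : oangle O C A < Real.pi := (Complex.arg_le_pi _).lt_of_ne (oangle_ne_pi hCA)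
    have l1' : -Real.pi < oangle O A B := Complex.neg_pi_lt_arg _
    have l2' : -Real.pi < oangle O B C := Complex.neg_pi_lt_arg _
    have l3' : -Real.pi < oangle O C A := Complex.neg_pi_lt_arg _
    rcases hcases with h0 | h0 | h0
    · exact h0
    · refine absurd (mem_convexHull_triple_of_smul_sub_eq_zero (p2.1 (by linarith))
        (p3.1 (by linarith)) (p1.1 (by linarith)) ?_) hO
      apply Complex.ext <;> simp <;> ring
    · refine absurd (mem_convexHull_triple_of_smul_sub_eq_zero
        (neg_pos.2 (n2.1 (by linarith))) (neg_pos.2 (n3.1 (by linarith)))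
        (neg_pos.2 (n1.1 (by linarith))) ?_) hO
      apply Complex.ext <;> simp <;> ring
end

section
/- Let l = A₁…A_m be a closed polygonal line in the plane and let O be a point that does not lie in the convex hull of the set {A₁, …, A_m}. Then O does not lie on l and w(l, O) = 0. -/
/-- The cyclic (oriented) edges of a closed polygonal line given by its list of vertices. -/
def cyc (l : List ℂ) : List (ℂ × ℂ) := l.zip (l.rotate 1)

/-- A closed polygonal line passes through `X` if `X` lies on one of its edges. -/
def passes (l : List ℂ) (X : ℂ) : Prop := ∃ e ∈ cyc l, X ∈ segment ℝ e.1 e.2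

/-- The winding number of a closed polygonal line around `O`. -/
noncomputable def wind (l : List ℂ) (O : ℂ) : ℝ :=
  ((cyc l).map (fun e => oangle O e.1 e.2)).sum / (2 * Real.pi)

theorem Complex.arg_div_of_re_pos {z w : ℂ} (hz : 0 < z.re) (hw : 0 < w.re) :
    Complex.arg (z / w) = Complex.arg z - Complex.arg w := by
  have hz0 : z ≠ 0 := by rintro rfl; simp at hz
  have hw0 : w ≠ 0 := by rintro rfl; simp at hw
  have h1 := abs_lt.1 (Complex.abs_arg_lt_pi_div_two_iff.2 (Or.inl hz))
  have h2 := abs_lt.1 (Complex.abs_arg_lt_pi_div_two_iff.2 (Or.inl hw))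
  have h := Complex.arg_div_coe_angle hz0 hw0
  rw [← Real.Angle.coe_sub] at h
  rw [← Complex.arg_coe_angle_toReal_eq_arg, h, Real.Angle.toReal_coe_eq_self_iff]
  constructor <;> linarith [h1.1, h1.2, h2.1, h2.2]

/-- Angles seen from `O` are differences of arguments after rotating an open half-plane with `O`
on its boundary onto the right half-plane. -/
theorem oangle_eq_arg_sub_arg {c O A B : ℂ} (hA : 0 < (c * (A - O)).re)
    (hB : 0 < (c * (B - O)).re) :
    oangle O A B = Complex.arg (c * (B - O)) - Complex.arg (c * (A - O)) := by
  have hc : c ≠ 0 := by rintro rfl; simp at hA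
  rw [← Complex.arg_div_of_re_pos hB hA, mul_div_mul_left _ _ hc, oangle]

/-- The functional `f` on `ℂ` is the real part of multiplication by a complex number. -/
theorem exists_re_mul_eq (f : ℂ →L[ℝ] ℝ) : ∃ c : ℂ, ∀ z, (c * z).re = f z := by
  refine ⟨⟨f 1, -f Complex.I⟩, fun z => ?_⟩
  have hz : z = z.re • (1 : ℂ) + z.im • Complex.I := by
    apply Complex.ext <;> simp
  conv_rhs => rw [hz, map_add, map_smul, map_smul]
  simp only [Complex.mul_re, smul_eq_mul]
  ring

theorem exists_re_mul_sub_pos {s : Set ℂ} (hs : s.Finite) {O : ℂ} (hO : O ∉ convexHull ℝ s) :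
    ∃ c : ℂ, ∀ x ∈ s, 0 < (c * (x - O)).re := by
  obtain ⟨f, u, hfO, hf⟩ := geometric_hahn_banach_point_closed (convex_convexHull ℝ s)
    (hs.isClosed_convexHull ℝ) hO
  obtain ⟨c, hc⟩ := exists_re_mul_eq f
  refine ⟨c, fun x hx => ?_⟩
  rw [hc, map_sub]
  linarith [hf x (subset_convexHull ℝ s hx)]

theorem mem_of_mem_cyc {l : List ℂ} {e : ℂ × ℂ} (he : e ∈ cyc l) : e.1 ∈ l ∧ e.2 ∈ l := by
  have h := List.of_mem_zip (show (e.1, e.2) ∈ l.zip (l.rotate 1) from he)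
  exact ⟨h.1, List.mem_rotate.1 h.2⟩

theorem sum_map_cyc_sub (l : List ℂ) (g : ℂ → ℝ) :
    ((cyc l).map fun e => g e.2 - g e.1).sum = 0 := by
  have h1 : (cyc l).map Prod.fst = l := List.map_fst_zip (by simp)
  have h2 : (cyc l).map Prod.snd = l.rotate 1 := List.map_snd_zip (by simp)
  have hsub : ∀ L : List (ℂ × ℂ), (L.map fun e => g e.2 - g e.1).sum =
      ((L.map Prod.snd).map g).sum - ((L.map Prod.fst).map g).sum := by
    intro L
    induction L with
    | nil => simp
    | cons a L ih => simp only [List.map_cons, List.sum_cons, ih]; ring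
  rw [hsub, h1, h2, ((l.rotate_perm 1).map g).sum_eq, sub_self]

theorem stmt1 (l : List ℂ) (hl : l ≠ []) (O : ℂ)
    (hO : O ∉ convexHull ℝ {x : ℂ | x ∈ l}) :
    ¬ passes l O ∧ wind l O = 0 := by
  constructor
  · rintro ⟨e, he, hX⟩
    obtain ⟨h1, h2⟩ := mem_of_mem_cyc he
    exact hO (segment_subset_convexHull (s := {x : ℂ | x ∈ l}) h1 h2 hX)
  · obtain ⟨c, hc⟩ := exists_re_mul_sub_pos l.finite_toSet hO
    have hmap : (cyc l).map (fun e => oangle O e.1 e.2) =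
        (cyc l).map fun e => Complex.arg (c * (e.2 - O)) - Complex.arg (c * (e.1 - O)) :=
      List.map_congr_left fun e he =>
        oangle_eq_arg_sub_arg (hc _ (mem_of_mem_cyc he).1) (hc _ (mem_of_mem_cyc he).2)
    rw [wind, hmap, sum_map_cyc_sub l fun z => Complex.arg (c * (z - O)), zero_div]
end

section
/- Let A₁, …, A_m (m ≥ 3) be the vertices of a convex polygon listed counterclockwise, i.e., the points are pairwise distinct and for every i and every j the cross product det(A_{i+1} − A_i, A_j − A_i) is ≥ 0 (indices mod m). Let O be a point with det(A_{i+1} − A_i, O − A_i) > 0 for every i (so O is interior to the polygon and does not lie on its boundary). Then the winding number of the closed polygonal line A₁…A_m around O equals 1. -/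
/-- The cross product `det(z, w)` of two plane vectors. -/
def cross (z w : ℂ) : ℝ := z.re * w.im - z.im * w.re

theorem arg_div_mem_Ioo_of_cross_pos {a b : ℂ} (h : 0 < cross a b) :
    Complex.arg (b / a) ∈ Set.Ioo 0 Real.pi := by
  have ha : a ≠ 0 := by
    rintro rfl
    simp [cross] at h
  have him : 0 < (b / a).im := by
    have : (b / a).im = cross a b / Complex.normSq a := by
      rw [Complex.div_im, cross]
      ring
    rw [this]
    exact div_pos h (Complex.normSq_pos.2 ha)
  refine ⟨?_, Complex.arg_lt_pi_iff.2 (Or.inr him.ne')⟩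
  refine lt_of_le_of_ne (Complex.arg_nonneg_iff.2 him.le) fun h0 => ?_
  exact him.ne' (Complex.arg_eq_zero_iff.1 h0.symm).2

/-- The partial sums of the turning angles are polar angles relative to the first point. -/
theorem exists_pos_mul_exp_sum_arg {m : ℕ} {z : ℕ → ℂ} (h0 : ∀ n ≤ m, z n ≠ 0) :
    ∀ n ≤ m, ∃ r : ℝ, 0 < r ∧ z n = z 0 * (r * Complex.exp
      ((∑ j ∈ Finset.range n, Complex.arg (z (j + 1) / z j) : ℝ) * Complex.I)) := by
  intro n
  induction n with
  | zero => exact fun _ => ⟨1, one_pos, by simp⟩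
  | succ n ih =>
    intro hn
    obtain ⟨r, hr, hz⟩ := ih (by omega)
    have hzn := h0 n (by omega)
    refine ⟨r * ‖z (n + 1) / z n‖,
      mul_pos hr (norm_pos_iff.2 (div_ne_zero (h0 _ hn) hzn)), ?_⟩
    have hstep : z (n + 1) = z n * (z (n + 1) / z n) := by field_simp
    rw [Finset.sum_range_succ, Complex.ofReal_add, add_mul, Complex.exp_add]
    calc z (n + 1) = z n * (‖z (n + 1) / z n‖ *
          Complex.exp (Complex.arg (z (n + 1) / z n) * Complex.I)) := by
          rw [Complex.norm_mul_exp_arg_mul_I]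
          exact hstep
      _ = _ := by
          nth_rewrite 1 [hz]
          push_cast
          ring

theorem cross_self_mul_exp (a : ℂ) (r θ : ℝ) :
    cross a (a * (r * Complex.exp (θ * Complex.I))) = Complex.normSq a * r * Real.sin θ := by
  simp only [cross, Complex.mul_re, Complex.mul_im, Complex.exp_ofReal_mul_I_re,
    Complex.exp_ofReal_mul_I_im, Complex.ofReal_re, Complex.ofReal_im, Complex.normSq_apply]
  ring

/-- A vector in the cone spanned by `u` and `v`, off the ray of `v`, on the same side of the line
through `u` and `v` as the origin, and at least as long as both, is equal to `u`. -/
theorem eq_of_mem_cone_of_norm_le {u v w : ℂ} (huv : 0 < cross u v) (huw : 0 ≤ cross u w)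
    (hwv : 0 < cross w v) (hside : 0 ≤ cross (v - u) (w - u))
    (hu : ‖u‖ ≤ ‖w‖) (hv : ‖v‖ ≤ ‖w‖) : u = w := by
  obtain ⟨a, ha⟩ : ∃ a, a = cross w v / cross u v := ⟨_, rfl⟩
  obtain ⟨b, hb⟩ : ∃ b, b = cross u w / cross u v := ⟨_, rfl⟩
  have ha0 : 0 < a := ha ▸ div_pos hwv huv
  have hb0 : 0 ≤ b := hb ▸ div_nonneg huw huv.le
  have hab : a + b ≤ 1 := by
    rw [ha, hb, ← add_div, div_le_one huv]
    simp only [cross, Complex.sub_re, Complex.sub_im] at *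
    linarith
  have hw : w = a • u + b • v := by
    rw [ha, hb]
    have := huv.ne'
    apply Complex.ext <;>
      simp only [Complex.add_re, Complex.add_im, Complex.real_smul, Complex.re_ofReal_mul,
        Complex.im_ofReal_mul] <;> field_simp <;> simp only [cross] <;> ring
  have hw0 : 0 < ‖w‖ := by
    rw [norm_pos_iff]
    rintro rfl
    simp [cross] at hwv
  have hle : ‖w‖ ≤ a * ‖u‖ + b * ‖v‖ := by
    calc ‖w‖ = ‖a • u + b • v‖ := by rw [← hw]
      _ ≤ ‖a • u‖ + ‖b • v‖ := norm_add_le _ _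
      _ = _ := by rw [norm_smul, norm_smul, Real.norm_of_nonneg ha0.le, Real.norm_of_nonneg hb0]
  have hab1 : a + b = 1 := by
    refine le_antisymm hab (le_of_mul_le_mul_right ?_ hw0)
    nlinarith [mul_le_mul_of_nonneg_left hu ha0.le, mul_le_mul_of_nonneg_left hv hb0]
  rcases hb0.eq_or_lt with hb' | hb'
  · rw [← hb'] at hw hab1
    rw [hw, show a = 1 by linarith]
    simp
  · have hne : u ≠ v := by
      rintro rfl
      simp [cross, mul_comm] at huv
    have := norm_combo_lt_of_ne hu hv hne ha0 hb' hab1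
    rw [← hw] at this
    exact absurd this (lt_irrefl _)

theorem sum_arg_div_eq_two_pi {m : ℕ} (hm : 0 < m) {z : ℕ → ℂ} (hclosed : z m = z 0)
    (hturn : ∀ n < m, 0 < cross (z n) (z (n + 1)))
    (hmax : ∀ n ≤ m, ‖z n‖ ≤ ‖z 0‖)
    (hside : ∀ n < m, 0 ≤ cross (z (n + 1) - z n) (z 0 - z n))
    (hne : ∀ n, 0 < n → n < m → z n ≠ z 0) :
    ∑ j ∈ Finset.range m, Complex.arg (z (j + 1) / z j) = 2 * Real.pi := by
  have hnz : ∀ n < m, z n ≠ 0 := by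
    intro n hn h
    have := hturn n hn
    simp [h, cross] at this
  have hz0 : z 0 ≠ 0 := hnz 0 hm
  have hpolar := exists_pos_mul_exp_sum_arg (m := m) (z := z) fun n hn => by
    rcases hn.eq_or_lt with rfl | hn
    · rwa [hclosed]
    · exact hnz n hn
  obtain ⟨θ, hθ⟩ : ∃ θ : ℕ → ℝ,
    ∀ n, θ n = ∑ j ∈ Finset.range n, Complex.arg (z (j + 1) / z j) := ⟨_, fun _ => rfl⟩
  simp only [← hθ] at hpolar ⊢
  have hθ0 : θ 0 = 0 := by simp [hθ]
  have hstep : ∀ n < m, θ n < θ (n + 1) ∧ θ (n + 1) < θ n + Real.pi := by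
    intro n hn
    have h := arg_div_mem_Ioo_of_cross_pos (hturn n hn)
    rw [hθ (n + 1), Finset.sum_range_succ, ← hθ]
    exact ⟨by linarith [h.1], by linarith [h.2]⟩
  have hpi := Real.pi_pos
  have hpos : ∀ n, 0 < n → n ≤ m → 0 < θ n := fun n hn hnm => by
    rw [hθ]
    refine Finset.sum_pos (fun j hj => ?_) (by simpa using hn.ne')
    exact (arg_div_mem_Ioo_of_cross_pos (hturn j (by grind))).1
  have hcross : ∀ n ≤ m, ∃ c : ℝ, 0 < c ∧ cross (z 0) (z n) = c * Real.sin (θ n) := by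
    intro n hn
    obtain ⟨r, hr, h⟩ := hpolar n hn
    refine ⟨_, mul_pos (Complex.normSq_pos.2 hz0) hr, ?_⟩
    rw [h, cross_self_mul_exp]
  have hle : θ m ≤ 2 * Real.pi := by
    by_contra! hgt
    classical
    have hex : ∃ n, 2 * Real.pi < θ n := ⟨m, hgt⟩
    have hkm : Nat.find hex ≤ m := Nat.find_min' hex hgt
    have hk := Nat.find_spec hex
    have hlt : ∀ n < Nat.find hex, θ n ≤ 2 * Real.pi := fun n hn =>
      not_lt.1 (Nat.find_min hex hn)
    generalize Nat.find hex = k at hkm hk hlt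
    obtain _ | i := k
    · linarith
    have hi := hlt i (by omega)
    obtain ⟨-, hs⟩ := hstep i hkm
    have hi0 : 0 < i := by
      rcases i.eq_zero_or_pos with rfl | h
      · linarith
      · exact h
    obtain ⟨c, hc, hci⟩ := hcross i (by omega)
    obtain ⟨d, hd, hdi⟩ := hcross (i + 1) hkm
    have hsin : Real.sin (θ i) ≤ 0 := by
      rw [← Real.sin_sub_two_pi]
      exact Real.sin_nonpos_of_nonpos_of_neg_pi_le (by linarith) (by linarith)
    have hsin' : 0 < Real.sin (θ (i + 1)) := by
      rw [← Real.sin_sub_two_pi]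
      exact Real.sin_pos_of_pos_of_lt_pi (by linarith) (by linarith)
    refine hne i hi0 hkm (eq_of_mem_cone_of_norm_le (hturn i hkm) ?_ ?_ (hside i hkm)
      (hmax i (by omega)) (hmax _ hkm))
    · have : cross (z i) (z 0) = -cross (z 0) (z i) := by simp only [cross]; ring
      rw [this, hci]
      nlinarith
    · rw [hdi]
      positivity
  obtain ⟨r, hr, hrm⟩ := hpolar m le_rfl
  have hone : (r : ℂ) * Complex.exp (θ m * Complex.I) = 1 := by
    rw [hclosed] at hrm
    exact mul_left_cancel₀ hz0 (by rw [← hrm, mul_one])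
  have hre : r * Real.cos (θ m) = 1 := by
    simpa [Complex.exp_ofReal_mul_I_re] using congrArg Complex.re hone
  have him : Real.sin (θ m) = 0 := by
    simpa [Complex.exp_ofReal_mul_I_im, hr.ne'] using congrArg Complex.im hone
  have hcos : Real.cos (θ m) = 1 := by
    rcases Real.sin_eq_zero_iff_cos_eq.1 him with h | h
    · exact h
    · rw [h] at hre
      linarith
  obtain ⟨k, hk⟩ := (Real.cos_eq_one_iff _).1 hcos
  have hm0 := hpos m hm le_rfl
  have hk0 : (0 : ℝ) < k := by
    by_contra! h
    nlinarith
  have hk1 : (k : ℝ) ≤ 1 := by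
    by_contra! h
    nlinarith
  have : k = 1 := by
    have h0 : 0 < k := by exact_mod_cast hk0
    have h1 : k ≤ 1 := by exact_mod_cast hk1
    omega
  rw [← hk, this]
  simp

theorem sum_range_add_of_periodic {M : Type*} [AddCommMonoid M] {f : ℕ → M} {m : ℕ}
    (hf : Function.Periodic f m) (s : ℕ) :
    ∑ j ∈ Finset.range m, f (s + j) = ∑ j ∈ Finset.range m, f j := by
  induction s with
  | zero => simp
  | succ s ih =>
    rw [← ih]
    cases m with
    | zero => simp
    | succ m =>
      rw [Finset.sum_range_succ, Finset.sum_range_succ']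
      congr 1
      · exact Finset.sum_congr rfl fun j _ => by congr 1; ring
      · rw [show s + 1 + m = s + (m + 1) by ring, hf, add_zero]

theorem stmt2 (m : ℕ) (hm : 3 ≤ m) (A : ℕ → ℂ) (O : ℂ)
    (hdist : ∀ i < m, ∀ j < m, i ≠ j → A i ≠ A j)
    (hconv : ∀ i < m, ∀ j < m, 0 ≤ cross (A ((i + 1) % m) - A i) (A j - A i))
    (hO : ∀ i < m, 0 < cross (A ((i + 1) % m) - A i) (O - A i)) :
    (∑ j ∈ Finset.range m, oangle O (A j) (A ((j + 1) % m))) / (2 * Real.pi) = 1 := by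
  have hm0 : 0 < m := by omega
  obtain ⟨s, hs, hmax⟩ := Finset.exists_max_image (Finset.range m) (fun n => ‖A n - O‖)
    ⟨0, Finset.mem_range.2 hm0⟩
  rw [Finset.mem_range] at hs
  have hmod : ∀ n, n % m < m := fun n => Nat.mod_lt _ hm0
  have hsum := sum_arg_div_eq_two_pi hm0 (z := fun n => A ((s + n) % m) - O) (by simp)
    (fun n _ => by
      have h := hO _ (hmod (s + n))
      rw [Nat.mod_add_mod, add_assoc] at h
      simp only [cross, Complex.sub_re, Complex.sub_im] at h ⊢
      linarith)
    (fun n _ => by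
      simpa [Nat.mod_eq_of_lt hs] using hmax _ (Finset.mem_range.2 (hmod (s + n))))
    (fun n _ => by
      have h := hconv _ (hmod (s + n)) _ (hmod s)
      rw [Nat.mod_add_mod, add_assoc] at h
      simpa using h)
    (fun n hn hnm => by
      have hne : (s + n) % m ≠ s % m := fun h => by
        have : n ≡ 0 [MOD m] := Nat.ModEq.add_left_cancel' s (by simpa [Nat.ModEq] using h)
        rw [Nat.ModEq, Nat.mod_eq_of_lt hnm, Nat.zero_mod] at this
        omega
      simpa using hdist _ (hmod _) _ (hmod _) hne)
  have hshift := sum_range_add_of_periodic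
    (f := fun n => oangle O (A (n % m)) (A ((n + 1) % m))) (m := m)
    (fun n => by simp [show n + m + 1 = n + 1 + m by ring]) s
  have hrange : ∑ j ∈ Finset.range m, oangle O (A j) (A ((j + 1) % m)) = 2 * Real.pi := by
    rw [← hsum]
    refine Eq.trans (Finset.sum_congr rfl fun j hj => ?_) hshift.symm
    rw [Nat.mod_eq_of_lt (Finset.mem_range.1 hj)]
  rw [hrange]
  exact div_self Real.two_pi_pos.ne'
end

section
/- (Borsuk–Ulam, low-dimensional case.) Let k ≥ 1 and let A₁…A_{2k} be a closed polygonal line in the plane not passing through a point O and centrally symmetric about O, i.e., A_{k+j} = 2O − A_j for every j = 1, …, k. Then the winding number w(A₁…A_{2k}, O) is an odd integer: there exists n : ℤ with w(A₁…A_{2k}, O) = 2n + 1. -/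
/-- Modulo `2π`, the oriented angles along a polygonal line telescope. -/
theorem coe_sum_oangle (A : ℕ → ℂ) (O : ℂ) (k : ℕ) (h : ∀ j ≤ k, A j ≠ O) :
    ((∑ j ∈ Finset.range k, oangle O (A j) (A (j + 1)) : ℝ) : Real.Angle)
      = Complex.arg (A k - O) - Complex.arg (A 0 - O) := by
  induction k with
  | zero => simp
  | succ k ih =>
    rw [Finset.sum_range_succ, Real.Angle.coe_add, ih fun j hj => h j (by omega), oangle,
      Complex.arg_div_coe_angle (sub_ne_zero.2 (h (k + 1) le_rfl))
        (sub_ne_zero.2 (h k (by omega)))]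
    abel

/-- Oriented angles are invariant under the central symmetry about their vertex. -/
theorem oangle_reflect (O A B : ℂ) : oangle O (2 * O - A) (2 * O - B) = oangle O A B := by
  have h (X : ℂ) : 2 * O - X - O = -(X - O) := by ring
  rw [oangle, oangle, h, h, neg_div_neg_eq]

theorem stmt5 (k : ℕ) (hk : 1 ≤ k) (A : ℕ → ℂ) (O : ℂ)
    (hO : ∀ j < 2 * k, O ∉ segment ℝ (A j) (A ((j + 1) % (2 * k))))
    (hsym : ∀ j < k, A (k + j) = 2 * O - A j) :
    ∃ n : ℤ,
      (∑ j ∈ Finset.range (2 * k), oangle O (A j) (A ((j + 1) % (2 * k)))) / (2 * Real.pi)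
        = 2 * n + 1 := by
  have hne : ∀ j < 2 * k, A j ≠ O := fun j hj h =>
    hO j hj (h ▸ left_mem_segment ℝ (A j) _)
  have hAk : A k = 2 * O - A 0 := by simpa using hsym 0 hk
  have first_half : ∀ j ∈ Finset.range k,
      oangle O (A j) (A ((j + 1) % (2 * k))) = oangle O (A j) (A (j + 1)) := by
    intro j hj
    rw [Finset.mem_range] at hj
    rw [Nat.mod_eq_of_lt (by omega)]
  have second_half : ∀ j ∈ Finset.range k,
      oangle O (A (k + j)) (A ((k + j + 1) % (2 * k))) = oangle O (A j) (A (j + 1)) := by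
    intro j hj
    rw [Finset.mem_range] at hj
    have hnext : A ((k + j + 1) % (2 * k)) = 2 * O - A (j + 1) := by
      rcases Nat.lt_or_ge (j + 1) k with hlt | hge
      · rw [Nat.mod_eq_of_lt (by omega), add_assoc, hsym _ hlt]
      · obtain rfl : k = j + 1 := by omega
        rw [show j + 1 + j + 1 = 2 * (j + 1) by ring, Nat.mod_self, hAk]
        ring
    rw [hnext, hsym j hj, oangle_reflect]
  have hangle : ((∑ j ∈ Finset.range k, oangle O (A j) (A (j + 1)) : ℝ) : Real.Angle)
      = (Real.pi : ℝ) := by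
    rw [coe_sum_oangle A O k fun j hj => hne j (by omega), hAk,
      show 2 * O - A 0 - O = -(A 0 - O) by ring,
      Complex.arg_neg_coe_angle (sub_ne_zero.2 (hne 0 (by omega)))]
    abel
  obtain ⟨n, hn⟩ := Real.Angle.angle_eq_iff_two_pi_dvd_sub.1 hangle
  refine ⟨n, ?_⟩
  rw [two_mul k, Finset.sum_range_add, ← two_mul k, Finset.sum_congr rfl first_half,
    Finset.sum_congr rfl second_half, sub_eq_iff_eq_add.1 hn]
  field_simp [Real.pi_ne_zero]
  ring
end

section
/- Let O, A, B be three pairwise distinct points in the plane, and let l₁, l₂, l₃ be open polygonal lines each beginning at A and ending at B, none of whose edges contain O. Then w(l₁·l₂⁻¹, O) + w(l₂·l₃⁻¹, O) = w(l₁·l₃⁻¹, O), where lᵢ·lⱼ⁻¹ denotes the closed polygonal line obtained by traversing lᵢ from A to B and then lⱼ in reverse from B back to A. -/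
/-- The (oriented) edges of an open polygonal line given by its list of vertices. -/
def opairs (l : List ℂ) : List (ℂ × ℂ) := l.zip l.tail

/-- `wconcat l l'` is the closed polygonal line obtained by traversing the open polygonal
line `l` (from `A` to `B`) and then the open polygonal line `l'` (also from `A` to `B`)
in reverse, from `B` back to `A`. -/
def wconcat (l l' : List ℂ) : List ℂ := l ++ l'.reverse.tail.dropLast

theorem oangle_swap {O A B : ℂ} (h : O ∉ segment ℝ A B) : oangle O B A = -oangle O A B := by
  have hA : A - O ≠ 0 := fun hA => h (sub_eq_zero.1 hA ▸ left_mem_segment ℝ A B)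
  have harg : Complex.arg ((B - O) / (A - O)) ≠ Real.pi := by
    intro hpi
    obtain ⟨hre, him⟩ := Complex.arg_eq_pi_iff.1 hpi
    set z := (B - O) / (A - O) with hz
    have hzre : z = (z.re : ℂ) := Complex.ext rfl (by simpa using him)
    have hB : B - O = z.re * (A - O) := by
      rw [← hzre, hz, div_mul_cancel₀ _ hA]
    have hpos : 0 < 1 - z.re := by linarith
    have hne : (1 - z.re : ℂ) ≠ 0 := by exact_mod_cast hpos.ne'
    refine h ⟨-z.re / (1 - z.re), 1 / (1 - z.re), by apply div_nonneg <;> linarith,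
      by positivity, by field_simp; ring, ?_⟩
    have hB' : B = O + z.re * (A - O) := by rw [← hB]; ring
    simp only [Complex.real_smul]
    push_cast
    generalize (z.re : ℂ) = r at hB' hne
    rw [hB']
    field_simp
    ring
  unfold oangle
  rw [← inv_div, Complex.arg_inv, if_neg harg]

theorem opairs_append_cons (b : ℂ) (l l' : List ℂ) :
    opairs (l ++ b :: l') = opairs (l ++ [b]) ++ opairs (b :: l') := by
  induction l with
  | nil => simp [opairs]
  | cons a l ih =>
    cases l with
    | nil => simp [opairs]
    | cons c l => simpa [opairs] using ih

theorem cyc_cons (a : ℂ) (l : List ℂ) : cyc (a :: l) = opairs (a :: l ++ [a]) := by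
  have h := List.zip_append (l₁ := a :: l) (r₁ := [a]) (l₂ := l ++ [a]) (r₂ := []) (by simp)
  simpa [cyc, opairs] using h.symm

/-- The sum of the oriented angles subtended at `O` by the edges of an open polygonal line. -/
noncomputable def angleSum (O : ℂ) (l : List ℂ) : ℝ :=
  ((opairs l).map (fun e => oangle O e.1 e.2)).sum

theorem angleSum_append_cons (O b : ℂ) (l l' : List ℂ) :
    angleSum O (l ++ b :: l') = angleSum O (l ++ [b]) + angleSum O (b :: l') := by
  simp [angleSum, opairs_append_cons b l l']

theorem angleSum_reverse (O : ℂ) (l : List ℂ)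
    (h : ∀ e ∈ opairs l, O ∉ segment ℝ e.1 e.2) :
    angleSum O l.reverse = -angleSum O l := by
  induction l with
  | nil => simp [angleSum, opairs]
  | cons a l ih =>
    cases l with
    | nil => simp [angleSum, opairs]
    | cons b l =>
      have hcons : opairs (a :: b :: l) = (a, b) :: opairs (b :: l) := rfl
      rw [hcons, List.forall_mem_cons] at h
      have ih := ih h.2
      have hswap := oangle_swap h.1
      have hpair : angleSum O [b, a] = oangle O b a := by simp [angleSum, opairs]
      have hsum : angleSum O (a :: b :: l) = oangle O a b + angleSum O (b :: l) := by
        simp [angleSum, hcons]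
      have hrev : (a :: b :: l).reverse = l.reverse ++ b :: [a] := by simp
      rw [hrev, angleSum_append_cons, ← List.reverse_cons, ih, hpair, hsum, hswap]
      ring

theorem exists_eq_cons_append_singleton {α : Type*} {A B : α} (hAB : A ≠ B) {l : List α}
    (hA : l.head? = some A) (hB : l.getLast? = some B) : ∃ m, l = A :: (m ++ [B]) := by
  obtain ⟨t, rfl⟩ := List.head?_eq_some_iff.1 hA
  obtain ⟨s, hs⟩ := List.getLast?_eq_some_iff.1 hB
  cases s with
  | nil => simp_all
  | cons c s =>
    simp only [List.cons_append, List.cons.injEq] at hs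
    exact ⟨s, by rw [hs.2]⟩

theorem wind_wconcat {O A B : ℂ} (hAB : A ≠ B) {l l' : List ℂ}
    (hA : l.head? = some A) (hB : l.getLast? = some B)
    (hA' : l'.head? = some A) (hB' : l'.getLast? = some B)
    (hO' : ∀ e ∈ opairs l', O ∉ segment ℝ e.1 e.2) :
    wind (wconcat l l') O = (angleSum O l - angleSum O l') / (2 * Real.pi) := by
  obtain ⟨m, rfl⟩ := exists_eq_cons_append_singleton hAB hA hB
  obtain ⟨m', rfl⟩ := exists_eq_cons_append_singleton hAB hA' hB'
  have hw : wconcat (A :: (m ++ [B])) (A :: (m' ++ [B])) = A :: (m ++ B :: m'.reverse) := by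
    simp [wconcat]
  have hsplit : A :: (m ++ B :: m'.reverse) ++ [A] = (A :: m) ++ B :: (m'.reverse ++ [A]) := by
    simp
  have hrev : B :: (m'.reverse ++ [A]) = (A :: (m' ++ [B])).reverse := by simp
  have hsum : angleSum O (A :: (m ++ B :: m'.reverse) ++ [A]) =
      angleSum O (A :: (m ++ [B])) - angleSum O (A :: (m' ++ [B])) := by
    rw [hsplit, angleSum_append_cons, hrev, angleSum_reverse O _ hO', sub_eq_add_neg,
      List.cons_append]
  rw [← hsum, hw, wind, cyc_cons, angleSum]

theorem stmt7 (O A B : ℂ) (hOA : O ≠ A) (hOB : O ≠ B) (hAB : A ≠ B)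
    (l₁ l₂ l₃ : List ℂ)
    (h1A : l₁.head? = some A) (h1B : l₁.getLast? = some B)
    (h1O : ∀ e ∈ opairs l₁, O ∉ segment ℝ e.1 e.2)
    (h2A : l₂.head? = some A) (h2B : l₂.getLast? = some B)
    (h2O : ∀ e ∈ opairs l₂, O ∉ segment ℝ e.1 e.2)
    (h3A : l₃.head? = some A) (h3B : l₃.getLast? = some B)
    (h3O : ∀ e ∈ opairs l₃, O ∉ segment ℝ e.1 e.2) :
    wind (wconcat l₁ l₂) O + wind (wconcat l₂ l₃) O = wind (wconcat l₁ l₃) O := by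
  rw [wind_wconcat hAB h1A h1B h2A h2B h2O, wind_wconcat hAB h2A h2B h3A h3B h3O,
    wind_wconcat hAB h1A h1B h3A h3B h3O]
  ring
end

section
/- Let A₁…A_m be a closed polygonal line in the plane not passing through a point O, and let P be a point such that O does not lie on any of the segments [P, A₁], …, [P, A_m]. Then w(A₁…A_m, O) = Σ_{i=1}^{m} w(P A_i A_{i+1}, O), where A_{m+1} := A₁ and P A_i A_{i+1} denotes the closed triangular polygonal line with vertices P, A_i, A_{i+1}. -/
/-- A difference of values at the endpoints sums to zero over the cyclic edges. -/
theorem sum_cyc_sub (l : List ℂ) (f : ℂ → ℝ) :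
    ((cyc l).map (fun e => f e.1 - f e.2)).sum = 0 := by
  have hfst : (cyc l).map (fun e => f e.1) = l.map f := by
    rw [← Function.comp_def f Prod.fst, ← List.map_map, cyc, List.map_fst_zip (by simp)]
  have hsnd : (cyc l).map (fun e => f e.2) = (l.rotate 1).map f := by
    rw [← Function.comp_def f Prod.snd, ← List.map_map, cyc, List.map_snd_zip (by simp)]
  have hadd := List.sum_map_add (l := cyc l) (f := fun e => f e.1 - f e.2) (g := fun e => f e.2)
  simp only [sub_add_cancel] at hadd
  rw [hfst, hsnd, ((l.rotate_perm 1).map f).sum_eq] at hadd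
  linarith

/-- The winding number of a triangle whose sides at `P` avoid `O`. -/
theorem wind_triangle {O P A B : ℂ} (hB : O ∉ segment ℝ P B) :
    wind [P, A, B] O =
      oangle O A B / (2 * Real.pi) + (oangle O P A - oangle O P B) / (2 * Real.pi) := by
  simp [wind, cyc, oangle_swap hB]
  ring

theorem stmt9 (l : List ℂ) (hl : l ≠ []) (O P : ℂ)
    (hO : ¬ passes l O)
    (hP : ∀ X ∈ l, O ∉ segment ℝ P X) :
    wind l O = ((cyc l).map (fun e => wind [P, e.1, e.2] O)).sum := by
  have hmap : (cyc l).map (fun e => wind [P, e.1, e.2] O) =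
      (cyc l).map (fun e => oangle O e.1 e.2 / (2 * Real.pi) +
        (oangle O P e.1 / (2 * Real.pi) - oangle O P e.2 / (2 * Real.pi))) := by
    refine List.map_congr_left fun e he => ?_
    have hmem : e.2 ∈ l := List.mem_rotate.1 (List.of_mem_zip (a := e.1) (b := e.2) he).2
    rw [wind_triangle (hP _ hmem), sub_div]
  rw [hmap, List.sum_map_add, sum_cyc_sub l (fun X => oangle O P X / (2 * Real.pi)), add_zero]
  simp only [wind, div_eq_mul_inv, List.sum_map_mul_right]
end

section
/- Let l be a closed polygonal line in the plane and let p be an open polygonal line from a point P₀ to a point P₁ such that the union of the edges of p is disjoint from the union of the edges of l. Then l passes through neither P₀ nor P₁, and w(l, P₀) = w(l, P₁). -/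
theorem div_mem_slitPlane_of_notMem_segment {O A B : ℂ} (h : O ∉ segment ℝ A B) :
    (B - O) / (A - O) ∈ Complex.slitPlane := by
  by_contra hz
  rw [Complex.mem_slitPlane_iff, not_or, not_lt, not_not] at hz
  obtain ⟨hre, him⟩ := hz
  have hA : A - O ≠ 0 := by
    intro h0
    exact h (sub_eq_zero.mp h0 ▸ left_mem_segment ℝ A B)
  obtain ⟨t, ht⟩ : ∃ t : ℝ, t = -((B - O) / (A - O)).re := ⟨_, rfl⟩
  have ht0 : 0 ≤ t := by linarith
  have hdiv : (B - O) / (A - O) = -(t : ℂ) := by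
    apply Complex.ext
    · simp [ht]
    · simpa using him
  rw [div_eq_iff hA] at hdiv
  have h1 : (0 : ℝ) < 1 + t := by linarith
  have h1' : (1 + t : ℂ) ≠ 0 := by exact_mod_cast h1.ne'
  refine h ⟨t / (1 + t), 1 / (1 + t), by positivity, by positivity, by field_simp; ring, ?_⟩
  simp only [Complex.real_smul]
  push_cast
  field_simp
  linear_combination hdiv

theorem continuousAt_oangle {O A B : ℂ} (h : O ∉ segment ℝ A B) :
    ContinuousAt (fun X => oangle X A B) O := by
  have hA : A - O ≠ 0 := by
    intro h0
    exact h (sub_eq_zero.mp h0 ▸ left_mem_segment ℝ A B)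
  unfold oangle
  refine ContinuousAt.comp (g := Complex.arg) (f := fun X : ℂ => (B - X) / (A - X))
    (Complex.continuousAt_arg (div_mem_slitPlane_of_notMem_segment h)) ?_
  exact ContinuousAt.div (by fun_prop) (by fun_prop) hA

theorem continuousAt_wind {l : List ℂ} {O : ℂ} (h : ¬ passes l O) :
    ContinuousAt (wind l) O := by
  unfold wind
  refine ContinuousAt.div_const ?_ _
  exact tendsto_list_sum (cyc l) fun e he => continuousAt_oangle fun hO => h ⟨e, he, hO⟩

theorem List.sum_map_zip_sub {α G : Type*} [AddCommGroup G] (f : α → G) :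
    ∀ l m : List α, l.length = m.length →
      ((l.zip m).map fun e => f e.2 - f e.1).sum = (m.map f).sum - (l.map f).sum
  | [], [], _ => by simp
  | a :: l, b :: m, h => by
    have := List.sum_map_zip_sub f l m (by simpa using h)
    simp only [List.zip_cons_cons, List.map_cons, List.sum_cons, this]
    abel

theorem wind_eq_intCast {l : List ℂ} {O : ℂ} (h : ¬ passes l O) : ∃ n : ℤ, wind l O = n := by
  have key : ((((cyc l).map fun e => oangle O e.1 e.2).sum : ℝ) : Real.Angle) = 0 := by
    have hmap : ((((cyc l).map fun e => oangle O e.1 e.2).sum : ℝ) : Real.Angle) =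
        ((cyc l).map fun e => ((oangle O e.1 e.2 : ℝ) : Real.Angle)).sum := by
      rw [← Real.Angle.coe_coeHom, map_list_sum, List.map_map]
      rfl
    have hsub : ((cyc l).map fun e => ((oangle O e.1 e.2 : ℝ) : Real.Angle)) =
        (cyc l).map fun e => ((Complex.arg (e.2 - O) : ℝ) : Real.Angle) -
          (Complex.arg (e.1 - O) : ℝ) := by
      refine List.map_congr_left fun e he => ?_
      refine Complex.arg_div_coe_angle ?_ ?_
      · intro h0
        exact h ⟨e, he, sub_eq_zero.mp h0 ▸ right_mem_segment ℝ _ _⟩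
      · intro h0
        exact h ⟨e, he, sub_eq_zero.mp h0 ▸ left_mem_segment ℝ _ _⟩
    rw [hmap, hsub, cyc, List.sum_map_zip_sub
      (fun z => ((Complex.arg (z - O) : ℝ) : Real.Angle)) _ _ (by simp), sub_eq_zero]
    exact ((l.rotate_perm 1).map _).sum_eq
  obtain ⟨n, hn⟩ := Real.Angle.coe_eq_zero_iff.mp key
  refine ⟨n, ?_⟩
  rw [wind, ← hn, zsmul_eq_mul]
  field_simp

theorem wind_eq_of_isPreconnected {l : List ℂ} {s : Set ℂ} (hs : IsPreconnected s)
    (h : ∀ X ∈ s, ¬ passes l X) {X Y : ℂ} (hX : X ∈ s) (hY : Y ∈ s) : wind l X = wind l Y := by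
  have hdiscrete : DiscreteTopology (Set.range ((↑) : ℤ → ℝ)) :=
    Int.isClosedEmbedding_coe_real.isEmbedding.toHomeomorph.symm.isEmbedding.discreteTopology
  refine hs.constant_of_mapsTo (T := Set.range ((↑) : ℤ → ℝ)) ⟨hdiscrete⟩
    (fun Z hZ => (continuousAt_wind (h Z hZ)).continuousWithinAt) (fun Z hZ => ?_) hX hY
  obtain ⟨n, hn⟩ := wind_eq_intCast (h Z hZ)
  exact ⟨n, hn.symm⟩

theorem exists_mem_opairs_of_mem {x : ℂ} :
    ∀ {p : List ℂ}, 2 ≤ p.length → x ∈ p → ∃ f ∈ opairs p, x = f.1 ∨ x = f.2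
  | [a, b], _, hx => ⟨(a, b), by simp [opairs], by simpa using hx⟩
  | a :: b :: c :: p, _, hx => by
    rcases List.mem_cons.mp hx with rfl | hx
    · exact ⟨(x, b), by simp [opairs], Or.inl rfl⟩
    · obtain ⟨f, hf, hxf⟩ := exists_mem_opairs_of_mem (p := b :: c :: p) (by simp) hx
      exact ⟨f, List.mem_cons_of_mem _ hf, hxf⟩

theorem apply_head_eq_apply_getLast {β : Type*} (g : ℂ → β) {P₀ P₁ : ℂ} :
    ∀ {p : List ℂ}, (∀ f ∈ opairs p, g f.1 = g f.2) → p.head? = some P₀ →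
      p.getLast? = some P₁ → g P₀ = g P₁
  | [a], _, h0, h1 => by
    simp only [List.head?_cons, List.getLast?_singleton, Option.some.injEq] at h0 h1
    rw [← h0, ← h1]
  | a :: b :: p, h, h0, h1 => by
    simp only [List.head?_cons, Option.some.injEq] at h0
    subst h0
    refine (h (a, b) (by simp [opairs])).trans ?_
    refine apply_head_eq_apply_getLast g (p := b :: p)
      (fun f hf => h f (List.mem_cons_of_mem _ hf)) rfl ?_
    rwa [List.getLast?_cons_cons] at h1

theorem stmt11 (l p : List ℂ) (hl : l ≠ []) (hp : 2 ≤ p.length)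
    (P₀ P₁ : ℂ) (hp0 : p.head? = some P₀) (hp1 : p.getLast? = some P₁)
    (hdisj : Disjoint (⋃ e ∈ cyc l, segment ℝ e.1 e.2) (⋃ f ∈ opairs p, segment ℝ f.1 f.2)) :
    ¬ passes l P₀ ∧ ¬ passes l P₁ ∧ wind l P₀ = wind l P₁ := by
  have hedge : ∀ f ∈ opairs p, ∀ X ∈ segment ℝ f.1 f.2, ¬ passes l X := by
    rintro f hf X hX ⟨e, he, hXe⟩
    exact Set.disjoint_left.mp hdisj (Set.mem_biUnion he hXe) (Set.mem_biUnion hf hX)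
  have hvertex : ∀ X ∈ p, ¬ passes l X := by
    intro X hX
    obtain ⟨f, hf, rfl | rfl⟩ := exists_mem_opairs_of_mem hp hX
    · exact hedge f hf _ (left_mem_segment ℝ _ _)
    · exact hedge f hf _ (right_mem_segment ℝ _ _)
  refine ⟨hvertex _ (List.mem_of_mem_head? hp0), hvertex _ (List.mem_of_mem_getLast? hp1), ?_⟩
  exact apply_head_eq_apply_getLast (wind l) (fun f hf =>
    wind_eq_of_isPreconnected (convex_segment f.1 f.2).isPreconnected (hedge f hf)
      (left_mem_segment ℝ _ _) (right_mem_segment ℝ _ _)) hp0 hp1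
end

section
/- Let l be an open polygonal line from a point A to a point B and let p be an open polygonal line from a point C to a point D, such that the vertices of l together with the vertices of p are pairwise distinct and in general position. Then ∂(l × p) = l · p, where ∂(l × p) := w'(l, D) − w'(p, B) − w'(l, C) + w'(p, A) and l · p is the sum, over all pairs consisting of an oriented edge \vec{EF} of l and an oriented edge \vec{GH} of p whose underlying segments intersect, of the sign of that intersection point. -/
/-- The quantity `w'` for an open polygonal line: the sum of the oriented angles
`∠A_j O A_{j+1}` over consecutive vertices, divided by `2π`. -/
noncomputable def wind' (l : List ℂ) (O : ℂ) : ℝ :=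
  ((opairs l).map (fun e => oangle O e.1 e.2)).sum / (2 * Real.pi)

open scoped Classical in
/-- The contribution of a pair of oriented edges `e`, `f` to the signed intersection
number: `0` if the underlying segments do not intersect, and otherwise the sign of the
intersection point (`+1` if the traversal `e.1 e.2 f.1` is clockwise, `−1` otherwise). -/
noncomputable def isect (e f : ℂ × ℂ) : ℝ :=
  if (segment ℝ e.1 e.2 ∩ segment ℝ f.1 f.2).Nonempty then
    (if cross (e.2 - e.1) (f.1 - e.1) < 0 then 1 else -1)
  else 0

/-- The sum of the signs of the intersection points over all pairs of oriented edges. -/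
noncomputable def signedSum (L P : List (ℂ × ℂ)) : ℝ :=
  (L.map (fun e => (P.map (fun f => isect e f)).sum)).sum

/-- A finite collection of points is in general position if the points are pairwise distinct,
no three of them lie on a common line, and no three of the segments joining pairs of them
have a common interior point. -/
def GenPos (pts : List ℂ) : Prop :=
  pts.Pairwise (· ≠ ·) ∧
  (∀ a ∈ pts, ∀ b ∈ pts, ∀ c ∈ pts, a ≠ b → a ≠ c → b ≠ c →
    ¬ Collinear ℝ ({a, b, c} : Set ℂ)) ∧
  (∀ a₁ ∈ pts, ∀ b₁ ∈ pts, ∀ a₂ ∈ pts, ∀ b₂ ∈ pts, ∀ a₃ ∈ pts, ∀ b₃ ∈ pts,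
    ({a₁, b₁} : Set ℂ) ≠ {a₂, b₂} → ({a₁, b₁} : Set ℂ) ≠ {a₃, b₃} →
    ({a₂, b₂} : Set ℂ) ≠ {a₃, b₃} →
    ¬ ∃ x, x ∈ openSegment ℝ a₁ b₁ ∧ x ∈ openSegment ℝ a₂ b₂ ∧ x ∈ openSegment ℝ a₃ b₃)

theorem cross_ne_zero_of_not_collinear {a b c : ℂ} (hab : a ≠ b)
    (h : ¬ Collinear ℝ ({a, b, c} : Set ℂ)) : cross (b - a) (c - a) ≠ 0 := by
  intro h0
  apply h
  have hb : b - a ≠ 0 := sub_ne_zero.mpr hab.symm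
  have hn : Complex.normSq (b - a) ≠ 0 := by simpa [Complex.normSq_eq_zero] using hb
  rw [collinear_iff_of_mem (p₀ := a) (by simp)]
  refine ⟨b - a, ?_⟩
  have him : ((c - a) / (b - a)).im = 0 := by
    rw [Complex.div_im]
    simp only [cross] at h0
    field_simp
    linarith
  intro q hq
  simp only [Set.mem_insert_iff, Set.mem_singleton_iff] at hq
  rcases hq with rfl | rfl | rfl
  · exact ⟨0, by simp⟩
  · exact ⟨1, by simp⟩
  · refine ⟨((q - a) / (b - a)).re, ?_⟩
    have hre : ((((q - a) / (b - a)).re : ℝ) : ℂ) = (q - a) / (b - a) :=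
      Complex.ext (by simp) (by simp [him])
    rw [vadd_eq_add, Complex.real_smul, hre, div_mul_cancel₀ _ hb]
    ring

theorem im_div_eq_cross (z w : ℂ) : (w / z).im = cross z w / Complex.normSq z := by
  rw [Complex.div_im, cross]
  ring

theorem arg_div_mem_of_cross_pos {z w : ℂ} (h : 0 < cross z w) :
    0 < Complex.arg (w / z) ∧ Complex.arg (w / z) < Real.pi := by
  have hz : z ≠ 0 := by rintro rfl; simp [cross] at h
  have him : 0 < (w / z).im := by
    rw [im_div_eq_cross]
    exact div_pos h (Complex.normSq_pos.mpr hz)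
  constructor
  · refine lt_of_le_of_ne (Complex.arg_nonneg_iff.mpr him.le) fun h0 => ?_
    exact him.ne' (Complex.arg_eq_zero_iff.mp h0.symm).2
  · refine lt_of_le_of_ne (Complex.arg_le_pi _) fun h0 => ?_
    exact him.ne' (Complex.arg_eq_pi_iff.mp h0).2

theorem arg_div_mem_of_cross_neg {z w : ℂ} (h : cross z w < 0) :
    -Real.pi < Complex.arg (w / z) ∧ Complex.arg (w / z) < 0 := by
  have hz : z ≠ 0 := by rintro rfl; simp [cross] at h
  have him : (w / z).im < 0 := by
    rw [im_div_eq_cross]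
    exact div_neg_of_neg_of_pos h (Complex.normSq_pos.mpr hz)
  exact ⟨Complex.neg_pi_lt_arg _, Complex.arg_neg_iff.mpr him⟩

theorem arg_div_mem_of_cross_ne_zero {z w : ℂ} (h : cross z w ≠ 0) :
    (0 < cross z w ∧ 0 < Complex.arg (w / z) ∧ Complex.arg (w / z) < Real.pi) ∨
      (cross z w < 0 ∧ -Real.pi < Complex.arg (w / z) ∧ Complex.arg (w / z) < 0) :=
  h.lt_or_gt.symm.imp (fun h => ⟨h, arg_div_mem_of_cross_pos h⟩)
    (fun h => ⟨h, arg_div_mem_of_cross_neg h⟩)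

theorem exists_arg_mul_eq {x y : ℂ} (hx : x ≠ 0) (hy : y ≠ 0) :
    ∃ k : ℤ, Complex.arg (x * y) - (Complex.arg x + Complex.arg y) = 2 * Real.pi * k := by
  have h := Complex.arg_mul_coe_angle hx hy
  rw [← Real.Angle.coe_add] at h
  exact Real.Angle.angle_eq_iff_two_pi_dvd_sub.mp h

theorem int_cast_eq_of_abs_lt {k : ℤ} {r : ℤ} (h₁ : (r : ℝ) - 1 < k) (h₂ : (k : ℝ) < r + 1) :
    (k : ℝ) = r := by
  have h₃ : r - 1 < k := by exact_mod_cast h₁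
  have h₄ : k < r + 1 := by exact_mod_cast h₂
  have : k = r := by omega
  exact_mod_cast this

/-- Two positive angles whose rotations compose to a counterclockwise one add up to
less than `π`. -/
theorem arg_add_arg_lt_pi {a b c : ℂ} (hb : 0 < cross a b) (hc : 0 < cross b c)
    (h : 0 < cross a c) : Complex.arg (b / a) + Complex.arg (c / b) < Real.pi := by
  have ha0 : a ≠ 0 := by rintro rfl; simp [cross] at hb
  have hb0 : b ≠ 0 := by rintro rfl; simp [cross] at hc
  have hc0 : c ≠ 0 := by rintro rfl; simp [cross] at hc
  obtain ⟨k, hk⟩ := exists_arg_mul_eq (div_ne_zero hb0 ha0) (div_ne_zero hc0 hb0)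
  rw [div_mul_div_cancel₀' hb0] at hk
  have h₁ := arg_div_mem_of_cross_pos hb
  have h₂ := arg_div_mem_of_cross_pos hc
  have h₃ := arg_div_mem_of_cross_pos h
  have hpi := Real.pi_pos
  have := int_cast_eq_of_abs_lt (k := k) (r := 0) (by push_cast; nlinarith) (by push_cast; nlinarith)
  rw [this] at hk
  push_cast at hk
  linarith

theorem neg_pi_lt_arg_add_arg {a b c : ℂ} (hb : cross a b < 0) (hc : cross b c < 0)
    (h : cross a c < 0) : -Real.pi < Complex.arg (b / a) + Complex.arg (c / b) := by
  have ha0 : a ≠ 0 := by rintro rfl; simp [cross] at hb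
  have hb0 : b ≠ 0 := by rintro rfl; simp [cross] at hc
  have hc0 : c ≠ 0 := by rintro rfl; simp [cross] at hc
  obtain ⟨k, hk⟩ := exists_arg_mul_eq (div_ne_zero hb0 ha0) (div_ne_zero hc0 hb0)
  rw [div_mul_div_cancel₀' hb0] at hk
  have h₁ := arg_div_mem_of_cross_neg hb
  have h₂ := arg_div_mem_of_cross_neg hc
  have h₃ := arg_div_mem_of_cross_neg h
  have hpi := Real.pi_pos
  have := int_cast_eq_of_abs_lt (k := k) (r := 0) (by push_cast; nlinarith) (by push_cast; nlinarith)
  rw [this] at hk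
  push_cast at hk
  linarith

/-- The oriented angles between four cyclically consecutive vectors add up to a multiple
of `2π`. -/
theorem exists_sum_arg_eq {a b c d : ℂ} (ha : a ≠ 0) (hb : b ≠ 0) (hc : c ≠ 0) (hd : d ≠ 0) :
    ∃ k : ℤ, Complex.arg (b / a) + Complex.arg (c / b) + Complex.arg (d / c) +
      Complex.arg (a / d) = 2 * Real.pi * k := by
  obtain ⟨k₁, h₁⟩ := exists_arg_mul_eq (div_ne_zero hb ha) (div_ne_zero hc hb)
  obtain ⟨k₂, h₂⟩ := exists_arg_mul_eq (div_ne_zero hd hc) (div_ne_zero ha hd)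
  rw [div_mul_div_cancel₀' hb] at h₁
  rw [div_mul_div_cancel₀' hd] at h₂
  obtain ⟨k₃, h₃⟩ := exists_arg_mul_eq (div_ne_zero hc ha) (div_ne_zero ha hc)
  rw [div_mul_div_cancel₀' hc, div_self ha, Complex.arg_one] at h₃
  refine ⟨-(k₁ + k₂ + k₃), ?_⟩
  push_cast
  linarith

theorem sum_arg_of_cross_pos {a b c d : ℂ} (hab : 0 < cross a b) (hbc : 0 < cross b c)
    (hcd : 0 < cross c d) (hda : 0 < cross d a) :
    Complex.arg (b / a) + Complex.arg (c / b) + Complex.arg (d / c) + Complex.arg (a / d) =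
      2 * Real.pi := by
  have ha0 : a ≠ 0 := by rintro rfl; simp [cross] at hab
  have hb0 : b ≠ 0 := by rintro rfl; simp [cross] at hab
  have hc0 : c ≠ 0 := by rintro rfl; simp [cross] at hcd
  have hd0 : d ≠ 0 := by rintro rfl; simp [cross] at hcd
  obtain ⟨k, hk⟩ := exists_sum_arg_eq ha0 hb0 hc0 hd0
  have h₁ := arg_div_mem_of_cross_pos hab
  have h₂ := arg_div_mem_of_cross_pos hbc
  have h₃ := arg_div_mem_of_cross_pos hcd
  have h₄ := arg_div_mem_of_cross_pos hda
  have hpi := Real.pi_pos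
  have := int_cast_eq_of_abs_lt (k := k) (r := 1) (by push_cast; nlinarith) (by push_cast; nlinarith)
  rw [hk, this]
  simp

theorem sum_arg_of_cross_neg {a b c d : ℂ} (hab : cross a b < 0) (hbc : cross b c < 0)
    (hcd : cross c d < 0) (hda : cross d a < 0) :
    Complex.arg (b / a) + Complex.arg (c / b) + Complex.arg (d / c) + Complex.arg (a / d) =
      -(2 * Real.pi) := by
  have ha0 : a ≠ 0 := by rintro rfl; simp [cross] at hab
  have hb0 : b ≠ 0 := by rintro rfl; simp [cross] at hab
  have hc0 : c ≠ 0 := by rintro rfl; simp [cross] at hcd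
  have hd0 : d ≠ 0 := by rintro rfl; simp [cross] at hcd
  obtain ⟨k, hk⟩ := exists_sum_arg_eq ha0 hb0 hc0 hd0
  have h₁ := arg_div_mem_of_cross_neg hab
  have h₂ := arg_div_mem_of_cross_neg hbc
  have h₃ := arg_div_mem_of_cross_neg hcd
  have h₄ := arg_div_mem_of_cross_neg hda
  have hpi := Real.pi_pos
  have := int_cast_eq_of_abs_lt (k := k) (r := -1) (by push_cast; nlinarith) (by push_cast; nlinarith)
  rw [hk, this]
  simp

theorem sum_arg_of_cross_mixed {a b c d : ℂ} (hd : d = a - b + c)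
    (hab : cross a b ≠ 0) (hbc : cross b c ≠ 0) (hcd : cross c d ≠ 0) (hda : cross d a ≠ 0)
    (hpos : ¬ (0 < cross a b ∧ 0 < cross b c ∧ 0 < cross c d ∧ 0 < cross d a))
    (hneg : ¬ (cross a b < 0 ∧ cross b c < 0 ∧ cross c d < 0 ∧ cross d a < 0)) :
    Complex.arg (b / a) + Complex.arg (c / b) + Complex.arg (d / c) + Complex.arg (a / d) = 0 := by
  have ha0 : a ≠ 0 := by rintro rfl; simp [cross] at hab
  have hb0 : b ≠ 0 := by rintro rfl; simp [cross] at hab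
  have hc0 : c ≠ 0 := by rintro rfl; simp [cross] at hcd
  have hd0 : d ≠ 0 := by rintro rfl; simp [cross] at hcd
  obtain ⟨k, hk⟩ := exists_sum_arg_eq ha0 hb0 hc0 hd0
  have hac : cross a c = cross a b - cross d a := by
    rw [hd]; simp only [cross, Complex.add_re, Complex.add_im, Complex.sub_re, Complex.sub_im]; ring
  have hca : cross c a = cross d a - cross a b := by
    rw [hd]; simp only [cross, Complex.add_re, Complex.add_im, Complex.sub_re, Complex.sub_im]; ring
  have hsum : cross a b + cross c d = cross b c + cross d a := by
    rw [hd]; simp only [cross, Complex.add_re, Complex.add_im, Complex.sub_re, Complex.sub_im]; ring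
  have hpi := Real.pi_pos
  have bound : -(2 * Real.pi) < 2 * Real.pi * k ∧ 2 * Real.pi * k < 2 * Real.pi := by
    rw [← hk]
    have p₁ := fun h => arg_add_arg_lt_pi (a := a) (b := b) (c := c) h
    have p₂ := fun h => arg_add_arg_lt_pi (a := c) (b := d) (c := a) h
    have n₁ := fun h => neg_pi_lt_arg_add_arg (a := a) (b := b) (c := c) h
    have n₂ := fun h => neg_pi_lt_arg_add_arg (a := c) (b := d) (c := a) h
    rw [hac] at p₁ n₁
    rw [hca] at p₂ n₂
    have i₁ := arg_div_mem_of_cross_ne_zero hab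
    have i₂ := arg_div_mem_of_cross_ne_zero hbc
    have i₃ := arg_div_mem_of_cross_ne_zero hcd
    have i₄ := arg_div_mem_of_cross_ne_zero hda
    clear hk hac hca hd
    generalize Complex.arg (b / a) = t₁ at *
    generalize Complex.arg (c / b) = t₂ at *
    generalize Complex.arg (d / c) = t₃ at *
    generalize Complex.arg (a / d) = t₄ at *
    generalize cross a b = s₁ at *
    generalize cross b c = s₂ at *
    generalize cross c d = s₃ at *
    generalize cross d a = s₄ at *
    generalize Real.pi = π at *
    rcases i₁ with ⟨h₁, i₁, j₁⟩ | ⟨h₁, i₁, j₁⟩ <;> rcases i₂ with ⟨h₂, i₂, j₂⟩ | ⟨h₂, i₂, j₂⟩ <;>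
    rcases i₃ with ⟨h₃, i₃, j₃⟩ | ⟨h₃, i₃, j₃⟩ <;> rcases i₄ with ⟨h₄, i₄, j₄⟩ | ⟨h₄, i₄, j₄⟩ <;>
    simp only [h₁, h₂, h₃, h₄, h₁.not_gt, h₂.not_gt, h₃.not_gt, h₄.not_gt, and_self, and_true,
      and_false, not_true, not_false_eq_true, forall_const,
      IsEmpty.forall_iff] at hpos hneg p₁ p₂ n₁ n₂ <;>
    constructor <;>
    first
    | linarith
    | linarith [p₁ (by linarith)]
    | linarith [p₂ (by linarith)]
    | linarith [n₁ (by linarith)]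
    | linarith [n₂ (by linarith)]
  have := int_cast_eq_of_abs_lt (k := k) (r := 0) (by push_cast; nlinarith) (by push_cast; nlinarith)
  rw [hk, this]
  simp

theorem segments_inter_iff {E F G H : ℂ} (h₁ : cross (F - E) (G - E) ≠ 0)
    (h₂ : cross (F - E) (H - E) ≠ 0) (h₃ : cross (H - G) (E - G) ≠ 0)
    (h₄ : cross (H - G) (F - G) ≠ 0) :
    (segment ℝ E F ∩ segment ℝ G H).Nonempty ↔
      cross (F - E) (G - E) * cross (F - E) (H - E) < 0 ∧
      cross (H - G) (E - G) * cross (H - G) (F - G) < 0 := by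
  have key : ∀ {u x y : ℝ}, 0 ≤ u → u ≤ 1 → x ≠ 0 → y ≠ 0 → (1 - u) * x + u * y = 0 →
      x * y < 0 := by
    intro u x y hu hu1 hx hy hxy
    rcases hu.eq_or_lt with rfl | hu
    · simp_all
    · have : u * (x * y) = -((1 - u) * x ^ 2) := by linear_combination x * hxy
      rcases hu1.eq_or_lt with rfl | hu1
      · simp_all
      · have : u * (x * y) < 0 := by
          rw [this]
          have := mul_pos (sub_pos.mpr hu1) (pow_pos (abs_pos.mpr hx) 2)
          rw [sq_abs] at this
          linarith
        exact (pos_iff_neg_of_mul_neg this).mp hu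
  constructor
  · rintro ⟨x, hx, hx'⟩
    rw [segment_eq_image] at hx hx'
    obtain ⟨t, ⟨ht0, ht1⟩, rfl⟩ := hx
    obtain ⟨u, ⟨hu0, hu1⟩, hu⟩ := hx'
    have hre := congrArg Complex.re hu
    have him := congrArg Complex.im hu
    simp only [Complex.add_re, Complex.add_im, Complex.real_smul, Complex.mul_re, Complex.mul_im,
      Complex.ofReal_re, Complex.ofReal_im] at hre him
    refine ⟨key hu0 hu1 h₁ h₂ ?_, key ht0 ht1 h₃ h₄ ?_⟩
    · simp only [cross, Complex.sub_re, Complex.sub_im]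
      linear_combination (F.re - E.re) * him - (F.im - E.im) * hre
    · simp only [cross, Complex.sub_re, Complex.sub_im]
      linear_combination -(H.re - G.re) * him + (H.im - G.im) * hre
  · rintro ⟨h, h'⟩
    have par : ∀ {x y : ℝ}, x * y < 0 → x - y ≠ 0 ∧ 0 ≤ x / (x - y) ∧ x / (x - y) ≤ 1 := by
      intro x y hxy
      rcases mul_neg_iff.mp hxy with ⟨hx, hy⟩ | ⟨hx, hy⟩
      · have : 0 < x - y := by linarith
        exact ⟨this.ne', div_nonneg hx.le this.le, (div_le_one this).mpr (by linarith)⟩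
      · have : x - y < 0 := by linarith
        exact ⟨this.ne, div_nonneg_of_nonpos hx.le this.le,
          (div_le_one_of_neg this).mpr (by linarith)⟩
    obtain ⟨hn, hu0, hu1⟩ := par h
    obtain ⟨hn', ht0, ht1⟩ := par h'
    rw [segment_eq_image, segment_eq_image]
    refine ⟨_, ⟨_, ⟨ht0, ht1⟩, rfl⟩, ⟨_, ⟨hu0, hu1⟩, ?_⟩⟩
    simp only [cross, Complex.sub_re, Complex.sub_im] at hn hn'
    apply Complex.ext <;>
    simp only [cross, Complex.add_re, Complex.add_im, Complex.real_smul, Complex.mul_re,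
      Complex.mul_im, Complex.ofReal_re, Complex.ofReal_im, Complex.sub_re, Complex.sub_im]
    · field_simp
      ring
    · field_simp
      ring

theorem arg_div_eq_neg_of_cross_ne_zero {z w : ℂ} (h : cross z w ≠ 0) :
    Complex.arg (z / w) = -Complex.arg (w / z) := by
  have hpi : Complex.arg (w / z) ≠ Real.pi := by
    rcases h.lt_or_gt with h | h
    · have := arg_div_mem_of_cross_neg h
      linarith [Real.pi_pos]
    · exact (arg_div_mem_of_cross_pos h).2.ne
  rw [← inv_div, Complex.arg_inv, if_neg hpi]

theorem isect_eq_sum_oangle {E F G H : ℂ} (h₁ : cross (F - E) (G - E) ≠ 0)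
    (h₂ : cross (F - E) (H - E) ≠ 0) (h₃ : cross (H - G) (E - G) ≠ 0)
    (h₄ : cross (H - G) (F - G) ≠ 0) :
    isect (E, F) (G, H) =
      ((oangle H E F - oangle G E F) - (oangle F G H - oangle E G H)) / (2 * Real.pi) := by
  have e₁ : cross (F - E) (G - E) = -cross (G - F) (G - E) := by
    simp only [cross, Complex.sub_re, Complex.sub_im]; ring
  have e₂ : cross (F - E) (H - E) = cross (H - E) (H - F) := by
    simp only [cross, Complex.sub_re, Complex.sub_im]; ring
  have e₃ : cross (H - G) (E - G) = cross (G - E) (H - E) := by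
    simp only [cross, Complex.sub_re, Complex.sub_im]; ring
  have e₄ : cross (H - G) (F - G) = -cross (H - F) (G - F) := by
    simp only [cross, Complex.sub_re, Complex.sub_im]; ring
  have hiff := segments_inter_iff h₁ h₂ h₃ h₄
  have hsum : cross (G - E) (H - E) + cross (H - F) (G - F) =
      cross (H - E) (H - F) + cross (G - F) (G - E) := by
    simp only [cross, Complex.sub_re, Complex.sub_im]; ring
  rw [e₁] at h₁
  rw [e₂] at h₂
  rw [e₃] at h₃
  rw [e₄] at h₄
  rw [neg_ne_zero] at h₁ h₄
  rw [e₁, e₂, e₃, e₄] at hiff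
  have hθ : (oangle H E F - oangle G E F) - (oangle F G H - oangle E G H) =
      Complex.arg ((H - E) / (G - E)) + Complex.arg ((H - F) / (H - E)) +
      Complex.arg ((G - F) / (H - F)) + Complex.arg ((G - E) / (G - F)) := by
    have o₁ : oangle H E F = Complex.arg ((H - F) / (H - E)) := by
      rw [oangle, ← neg_sub H F, ← neg_sub H E, neg_div_neg_eq]
    have o₂ : oangle G E F = -Complex.arg ((G - E) / (G - F)) := by
      rw [oangle, ← neg_sub G F, ← neg_sub G E, neg_div_neg_eq, arg_div_eq_neg_of_cross_ne_zero h₁]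
    have o₃ : oangle F G H = -Complex.arg ((G - F) / (H - F)) := by
      rw [oangle, arg_div_eq_neg_of_cross_ne_zero h₄]
    rw [o₁, o₂, o₃, oangle]
    ring
  have hpi : 2 * Real.pi ≠ 0 := by positivity
  rw [hθ, isect]
  by_cases hpos : 0 < cross (G - E) (H - E) ∧ 0 < cross (H - E) (H - F) ∧
      0 < cross (H - F) (G - F) ∧ 0 < cross (G - F) (G - E)
  · obtain ⟨p₁, p₂, p₃, p₄⟩ := hpos
    rw [if_pos (hiff.mpr ⟨by nlinarith, by nlinarith⟩), if_pos (by rw [e₁]; linarith),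
      sum_arg_of_cross_pos p₁ p₂ p₃ p₄, div_self hpi]
  by_cases hneg : cross (G - E) (H - E) < 0 ∧ cross (H - E) (H - F) < 0 ∧
      cross (H - F) (G - F) < 0 ∧ cross (G - F) (G - E) < 0
  · obtain ⟨n₁, n₂, n₃, n₄⟩ := hneg
    rw [if_pos (hiff.mpr ⟨by nlinarith, by nlinarith⟩), if_neg (by rw [e₁]; linarith),
      sum_arg_of_cross_neg n₁ n₂ n₃ n₄, neg_div, div_self hpi]
  rw [sum_arg_of_cross_mixed (by ring) h₃ h₂ h₄ h₁ hpos hneg, zero_div, if_neg]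
  rw [hiff]
  rintro ⟨m₁, m₂⟩
  rw [neg_mul, neg_lt_zero] at m₁
  rw [mul_neg, neg_lt_zero] at m₂
  rcases pos_and_pos_or_neg_and_neg_of_mul_pos m₁ with ⟨q₁, q₂⟩ | ⟨q₁, q₂⟩ <;>
  rcases pos_and_pos_or_neg_and_neg_of_mul_pos m₂ with ⟨q₃, q₄⟩ | ⟨q₃, q₄⟩
  · exact hpos ⟨q₃, q₂, q₄, q₁⟩
  · linarith
  · linarith
  · exact hneg ⟨q₃, q₂, q₄, q₁⟩

theorem fst_mem_and_snd_mem_of_mem_opairs {l : List ℂ} {e : ℂ × ℂ} (h : e ∈ opairs l) :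
    e.1 ∈ l ∧ e.2 ∈ l :=
  ⟨(List.of_mem_zip h).1, List.mem_of_mem_tail (List.of_mem_zip h).2⟩

theorem fst_ne_snd_of_mem_opairs {l : List ℂ} (hl : l.Pairwise (· ≠ ·)) {e : ℂ × ℂ}
    (h : e ∈ opairs l) : e.1 ≠ e.2 := by
  cases l with
  | nil => simp [opairs] at h
  | cons a t =>
    induction t generalizing a with
    | nil => simp [opairs] at h
    | cons b t ih =>
      simp only [opairs, List.tail_cons, List.zip_cons_cons, List.mem_cons] at h
      rw [List.pairwise_cons] at hl
      rcases h with rfl | h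
      · exact hl.1 _ (by simp)
      · exact ih b hl.2 h

theorem sum_map_sub {α : Type*} (L : List α) (u v : α → ℝ) :
    (L.map (fun x => u x - v x)).sum = (L.map u).sum - (L.map v).sum := by
  induction L with
  | nil => simp
  | cons x L ih => simp only [List.map_cons, List.sum_cons, ih]; ring

theorem sum_map_div_const {α : Type*} (L : List α) (u : α → ℝ) (r : ℝ) :
    (L.map (fun x => u x / r)).sum = (L.map u).sum / r := by
  simp only [div_eq_mul_inv, List.sum_map_mul_right]

theorem sum_opairs_sub (g : ℂ → ℝ) {l : List ℂ} {A B : ℂ} (hA : l.head? = some A)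
    (hB : l.getLast? = some B) :
    ((opairs l).map (fun e => g e.2 - g e.1)).sum = g B - g A := by
  cases l with
  | nil => simp at hA
  | cons a t =>
    induction t generalizing a A with
    | nil => simp_all [opairs]
    | cons b t ih =>
      simp only [List.head?_cons, Option.some.injEq] at hA
      rw [List.getLast?_cons_cons] at hB
      have := ih b (List.head?_cons) hB
      simp only [opairs, List.tail_cons, List.zip_cons_cons, List.map_cons, List.sum_cons] at this ⊢
      rw [this, hA]
      ring

theorem stmt18 (l p : List ℂ) (hl : l ≠ []) (hp : p ≠ [])
    (A B C D : ℂ)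
    (hA : l.head? = some A) (hB : l.getLast? = some B)
    (hC : p.head? = some C) (hD : p.getLast? = some D)
    (h : GenPos (l ++ p)) :
    wind' l D - wind' p B - wind' l C + wind' p A = signedSum (opairs l) (opairs p) := by
  obtain ⟨hdist, hcol, -⟩ := h
  rw [List.pairwise_append] at hdist
  obtain ⟨hdl, hdp, hlp⟩ := hdist
  have hcross : ∀ x ∈ l ++ p, ∀ y ∈ l ++ p, ∀ z ∈ l ++ p, x ≠ y → x ≠ z → y ≠ z →
      cross (y - x) (z - x) ≠ 0 := fun x hx y hy z hz hxy hxz hyz =>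
    cross_ne_zero_of_not_collinear hxy (hcol x hx y hy z hz hxy hxz hyz)
  have hedge : ∀ e ∈ opairs l, ∀ f ∈ opairs p, isect e f =
      ((oangle f.2 e.1 e.2 - oangle f.1 e.1 e.2) -
        (oangle e.2 f.1 f.2 - oangle e.1 f.1 f.2)) / (2 * Real.pi) := by
    rintro ⟨E, F⟩ he ⟨G, H⟩ hf
    obtain ⟨hE, hF⟩ := fst_mem_and_snd_mem_of_mem_opairs he
    obtain ⟨hG, hH⟩ := fst_mem_and_snd_mem_of_mem_opairs hf
    have hEF := fst_ne_snd_of_mem_opairs hdl he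
    have hGH := fst_ne_snd_of_mem_opairs hdp hf
    have memL : ∀ {x}, x ∈ l → x ∈ l ++ p := fun h => List.mem_append_left _ h
    have memR : ∀ {x}, x ∈ p → x ∈ l ++ p := fun h => List.mem_append_right _ h
    exact isect_eq_sum_oangle
      (hcross _ (memL hE) _ (memL hF) _ (memR hG) hEF (hlp _ hE _ hG) (hlp _ hF _ hG))
      (hcross _ (memL hE) _ (memL hF) _ (memR hH) hEF (hlp _ hE _ hH) (hlp _ hF _ hH))
      (hcross _ (memR hG) _ (memR hH) _ (memL hE) hGH (hlp _ hE _ hG).symm (hlp _ hE _ hH).symm)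
      (hcross _ (memR hG) _ (memR hH) _ (memL hF) hGH (hlp _ hF _ hG).symm (hlp _ hF _ hH).symm)
  have hinner : ∀ e ∈ opairs l, ((opairs p).map (fun f => isect e f)).sum =
      (oangle D e.1 e.2 - oangle C e.1 e.2) / (2 * Real.pi) - (wind' p e.2 - wind' p e.1) := by
    intro e he
    rw [List.map_congr_left (hedge e he)]
    rw [sum_map_div_const, sum_map_sub, sum_opairs_sub (fun O => oangle O e.1 e.2) hC hD,
      sum_map_sub, wind', wind']
    ring
  rw [signedSum, List.map_congr_left hinner, sum_map_sub, sum_opairs_sub (wind' p) hA hB,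
    sum_map_div_const, sum_map_sub]
  simp only [wind']
  ring
end
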